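/- Let X be a set and k : X → X → ℂ a PSD kernel with k(x,y) ≠ 0 for all x, y ∈ X, and suppose k has the complete Pick property. Let N ≥ 2 and let x_1, ..., x_N, x_{N+1} ∈ X. For z ∈ X write F_z(x,y) := 1 − (k(x,z) * k(z,y)) / (k(z,z) * k(x,y)). If the (N−1)×(N−1) matrix (F_{x_N}(x_i, x_j))_{i,j=1,...,N−1} is positive semidefinite, then the N×N matrix (F_{x_{N+1}}(x_i, x_j))_{i,j=1,...,N} is positive semidefinite. -/

import Mathlib

open ComplexOrder Matrix

/-- A kernel `k : X → X → ℂ` is positive semidefinite if for every finite tuple of points the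
associated Gram-type matrix is positive semidefinite. -/
def IsPSDKernel {X : Type*} (k : X → X → ℂ) : Prop :=
  ∀ (n : ℕ) (x : Fin n → X), (Matrix.of fun i j : Fin n => k (x i) (x j)).PosSemidef

/-- Given `W : X → Matrix (Fin s) (Fin t) ℂ`, the operator-valued kernel `(1 - W W*) k` is PSD:
for every tuple `x : Fin n → X`, the block matrix with `((i,a),(j,b))` entry
`k (x i) (x j) * ((1 - W (x i) * (W (x j))ᴴ) a b)` is positive semidefinite. -/
def MultKernelPSD {X : Type*} (k : X → X → ℂ) {s t : ℕ}
    (W : X → Matrix (Fin s) (Fin t) ℂ) : Prop :=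
  ∀ (n : ℕ) (x : Fin n → X),
    (Matrix.of fun p q : Fin n × Fin s =>
      k (x p.1) (x q.1) *
        ((1 : Matrix (Fin s) (Fin s) ℂ) - W (x p.1) * (W (x q.1))ᴴ) p.2 q.2).PosSemidef

/-- The kernel `k` has the complete Pick property (matrix formulation). -/
def CompletePickProperty {X : Type*} (k : X → X → ℂ) : Prop :=
  ∀ (s t : ℕ) (S : Finset X) (W : X → Matrix (Fin s) (Fin t) ℂ),
    (∀ (n : ℕ) (x : Fin n → X), (∀ i, x i ∈ S) →
      (Matrix.of fun p q : Fin n × Fin s =>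
        k (x p.1) (x q.1) *
          ((1 : Matrix (Fin s) (Fin s) ℂ) - W (x p.1) * (W (x q.1))ᴴ) p.2 q.2).PosSemidef) →
    ∃ Φ : X → Matrix (Fin s) (Fin t) ℂ, (∀ x ∈ S, Φ x = W x) ∧ MultKernelPSD k Φ

/-- `F_z(x,y) = 1 - k(x,z) k(z,y) / (k(z,z) k(x,y))`. -/
noncomputable def pickF {X : Type*} (k : X → X → ℂ) (z x y : X) : ℂ :=
  1 - (k x z * k z y) / (k z z * k x y)

/-- A PSD kernel is Hermitian. -/
lemma IsPSDKernel.star_apply {X : Type*} {k : X → X → ℂ} (hk : IsPSDKernel k) (x y : X) :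
    star (k x y) = k y x := by
  simpa using (hk 2 ![x, y]).isHermitian.apply 1 0

/-- A PSD kernel is nonnegative on the diagonal. -/
lemma IsPSDKernel.diag_nonneg {X : Type*} {k : X → X → ℂ} (hk : IsPSDKernel k) (x : X) :
    0 ≤ k x x := by
  simpa using (hk 1 fun _ => x).diag_nonneg (i := 0)

/-- If every entry of a matrix outside the index set `Fin n ⊂ Fin (n + 1)` vanishes, positivity
of the corner gives positivity of the matrix. -/
lemma Matrix.PosSemidef.of_castSucc {n : ℕ} {A : Matrix (Fin (n + 1)) (Fin (n + 1)) ℂ}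
    (hA : (A.submatrix Fin.castSucc Fin.castSucc).PosSemidef)
    (hr : ∀ i, A (Fin.last n) i = 0) (hc : ∀ i, A i (Fin.last n) = 0) : A.PosSemidef := by
  refine Matrix.PosSemidef.of_dotProduct_mulVec_nonneg ?_ fun c => ?_
  · ext i j
    refine Fin.lastCases ?_ (fun i => ?_) i
    · simp [hr, hc]
    · refine Fin.lastCases ?_ (fun j => ?_) j
      · simp [hr, hc]
      · exact hA.isHermitian.apply i j
  · have := hA.dotProduct_mulVec_nonneg (fun i => c i.castSucc)
    simpa [dotProduct, mulVec, Fin.sum_univ_castSucc, hr, hc] using this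

open scoped MatrixOrder in
/-- A positive semidefinite kernel matrix on finitely many points is the Gram matrix of a
row-vector valued function on these points. -/
lemma exists_row_factorization {X : Type*} {n : ℕ} (K : X → X → ℂ) (p : Fin n → X)
    (h : (Matrix.of fun i j => K (p i) (p j)).PosSemidef) :
    ∃ W : X → Matrix (Fin 1) (Fin n) ℂ, ∀ x ∈ Set.range p, ∀ y ∈ Set.range p,
      (W x * (W y)ᴴ) 0 0 = K x y := by
  classical
  obtain ⟨B, hB⟩ : ∃ B : Matrix (Fin n) (Fin n) ℂ,
      (Matrix.of fun i j => K (p i) (p j)) = Bᴴ * B :=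
    CStarAlgebra.nonneg_iff_eq_star_mul_self.mp h.nonneg
  refine ⟨fun x => Matrix.of fun _ l =>
    if hx : x ∈ Set.range p then star (B l hx.choose) else 0, fun x hx y hy => ?_⟩
  have := congrFun (congrFun hB hx.choose) hy.choose
  simp only [Matrix.of_apply, hx.choose_spec, hy.choose_spec] at this
  rw [this]
  simp only [Matrix.mul_apply, Matrix.conjTranspose_apply, Matrix.of_apply, dif_pos hx, dif_pos hy,
    star_star]

lemma pickF_self_left {X : Type*} {k : X → X → ℂ} (hnz : ∀ x y : X, k x y ≠ 0) (z y : X) :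
    pickF k z z y = 0 := by
  rw [pickF, div_self (mul_ne_zero (hnz _ _) (hnz _ _)), sub_self]

lemma pickF_self_right {X : Type*} {k : X → X → ℂ} (hnz : ∀ x y : X, k x y ≠ 0) (z x : X) :
    pickF k z x z = 0 := by
  rw [pickF, mul_comm (k x z), div_self (mul_ne_zero (hnz _ _) (hnz _ _)), sub_self]

lemma mul_one_sub_pickF {X : Type*} {k : X → X → ℂ} (hnz : ∀ x y : X, k x y ≠ 0) (z x y : X) :
    k x y * (1 - pickF k z x y) = k x z * k z y / k z z := by
  have := hnz x y
  have := hnz z z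
  rw [pickF]
  field_simp
  ring

/-- Change of base point in `pickF`. -/
lemma pickF_change_base {X : Type*} {k : X → X → ℂ} (hnz : ∀ x y : X, k x y ≠ 0)
    (z w x y : X) :
    pickF k w x y = k z z / k w w * (k x w / k x z * (k w y / k z y) *
        (pickF k z x y - pickF k z w y - pickF k z x w + pickF k z w w)) +
      (k x w / k x z * (k w z / k w w) - 1) * (k w y / k z y * (k z w / k w w) - 1) := by
  simp only [pickF]
  have := hnz x y
  have := hnz x z
  have := hnz x w
  have := hnz z y
  have := hnz w y
  have := hnz z z
  have := hnz w w
  have := hnz z w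
  have := hnz w z
  field_simp
  ring

/-- A contractive row multiplier `Φ` that realizes `pickF k z` at `y` and vanishes at `z`
realizes `pickF k z` at `(w, y)` for every point `w`. -/
lemma MultKernelPSD.mul_eq_pickF {X : Type*} {k : X → X → ℂ}
    (hnz : ∀ x y : X, k x y ≠ 0) {t : ℕ} {Φ : X → Matrix (Fin 1) (Fin t) ℂ}
    (hΦ : MultKernelPSD k Φ) {z y : X} (hz : Φ z = 0)
    (hy : (Φ y * (Φ y)ᴴ) 0 0 = pickF k z y y) (w : X) :
    (Φ w * (Φ y)ᴴ) 0 0 = pickF k z w y := by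
  have hG := (hΦ 3 ![y, z, w]).submatrix (fun i : Fin 3 => (i, (0 : Fin 1)))
  have hyy := mul_one_sub_pickF hnz z y y
  have hwy := mul_one_sub_pickF hnz z w y
  have hzz := hnz z z
  have h0 := (hG.dotProduct_mulVec_zero_iff ![1, -(k z y / k z z), 0]).mp (by
    simp [dotProduct, mulVec, Fin.sum_univ_succ, hz, hy, hyy]
    field_simp
    ring)
  have h2 := congrFun h0 2
  simp [mulVec, dotProduct, Fin.sum_univ_succ, hz] at h2
  apply sub_right_injective (b := (1 : ℂ))
  apply mul_left_cancel₀ (hnz w y)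
  simp only [hwy]
  linear_combination h2

/-- A contractive row multiplier vanishing at `z` satisfies the pointwise Schwarz-Pick bound. -/
lemma MultKernelPSD.mul_self_le_pickF {X : Type*} {k : X → X → ℂ} (hk : IsPSDKernel k)
    (hnz : ∀ x y : X, k x y ≠ 0) {t : ℕ} {Φ : X → Matrix (Fin 1) (Fin t) ℂ}
    (hΦ : MultKernelPSD k Φ) {z : X} (hz : Φ z = 0) (w : X) :
    (Φ w * (Φ w)ᴴ) 0 0 ≤ pickF k z w w := by
  have hG := (hΦ 2 ![z, w]).submatrix (fun i : Fin 2 => (i, (0 : Fin 1)))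
  have hww := mul_one_sub_pickF hnz z w w
  have hzz := hnz z z
  have h0 := hG.dotProduct_mulVec_nonneg ![-(k z w / k z z), 1]
  have key : 0 ≤ k w w * (pickF k z w w - (Φ w * (Φ w)ᴴ) 0 0) := by
    convert h0 using 1
    simp [dotProduct, mulVec, Fin.sum_univ_succ, hz]
    have : k w w * pickF k z w w = k w w - k w z * k z w / k z z := by
      linear_combination -hww
    rw [mul_sub, this]
    field_simp
    ring
  exact sub_nonneg.mp (by
    simpa [hnz w w] using mul_nonneg (inv_nonneg.mpr (hk.diag_nonneg w)) key)

/-- For a complete Pick kernel, positivity of `pickF k z` on a finite family of points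
containing `z` passes to `pickF k w` for every other base point `w`. -/
lemma CompletePickProperty.posSemidef_pickF {X : Type*} {k : X → X → ℂ} (hk : IsPSDKernel k)
    (hnz : ∀ x y : X, k x y ≠ 0) (hcp : CompletePickProperty k) {n : ℕ} (p : Fin n → X)
    {z : X} (hzp : z ∈ Set.range p) (w : X)
    (h : (Matrix.of fun i j => pickF k z (p i) (p j)).PosSemidef) :
    (Matrix.of fun i j => pickF k w (p i) (p j)).PosSemidef := by
  classical
  obtain ⟨W, hW⟩ := exists_row_factorization (pickF k z) p h
  obtain ⟨Φ, hΦW, hΦ⟩ := hcp 1 n (Finset.univ.image p) W (by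
    intro m y hy
    have hy' : ∀ i, y i ∈ Set.range p := fun i => by simpa using hy i
    have hpos : 0 ≤ (k z z)⁻¹ := inv_nonneg.mpr (hk.diag_nonneg z)
    convert (Matrix.posSemidef_vecMulVec_self_star
      (fun q : Fin m × Fin 1 => k (y q.1) z)).smul hpos using 1
    ext ⟨i, a⟩ ⟨j, b⟩
    obtain rfl := Subsingleton.elim a 0
    obtain rfl := Subsingleton.elim b 0
    have := mul_one_sub_pickF hnz z (y i) (y j)
    simp only [Matrix.of_apply, Matrix.sub_apply, Matrix.one_apply_eq, hW _ (hy' i) _ (hy' j),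
      this, Matrix.smul_apply, Matrix.vecMulVec_apply, Pi.star_apply, hk.star_apply, smul_eq_mul]
    ring)
  have hΦ' : ∀ x ∈ Set.range p, ∀ y ∈ Set.range p, (Φ x * (Φ y)ᴴ) 0 0 = pickF k z x y := by
    intro x hx y hy
    rw [hΦW x (by simpa using hx), hΦW y (by simpa using hy), hW x hx y hy]
  have hz : Φ z = 0 := by
    rw [← Matrix.self_mul_conjTranspose_eq_zero]
    ext a b
    obtain rfl := Subsingleton.elim a 0
    obtain rfl := Subsingleton.elim b 0
    rw [hΦ' z hzp z hzp, pickF_self_left hnz]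
    rfl
  have hwy : ∀ y ∈ Set.range p, (Φ w * (Φ y)ᴴ) 0 0 = pickF k z w y := fun y hy =>
    hΦ.mul_eq_pickF hnz hz (hΦ' y hy y hy) w
  have hstar : ∀ x y, star (pickF k z x y) = pickF k z y x := fun x y => by
    simp only [pickF, star_sub, star_one, star_div₀, star_mul', hk.star_apply]
    ring
  have hyw : ∀ y ∈ Set.range p, (Φ y * (Φ w)ᴴ) 0 0 = pickF k z y w := fun y hy => by
    rw [← hstar, ← hwy y hy, ← Matrix.conjTranspose_apply, Matrix.conjTranspose_mul,
      Matrix.conjTranspose_conjTranspose]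
  have hδ : 0 ≤ pickF k z w w - (Φ w * (Φ w)ᴴ) 0 0 :=
    sub_nonneg.mpr (hΦ.mul_self_le_pickF hk hnz hz w)
  have hc : 0 ≤ k z z / k w w := div_nonneg (hk.diag_nonneg z) (hk.diag_nonneg w)
  let α : Fin n → ℂ := fun i => k (p i) w / k (p i) z
  let β : Fin n → ℂ := fun i => α i * (k w z / k w w) - 1
  let V : Matrix (Fin n) (Fin n) ℂ := Matrix.of fun i l => α i * (Φ (p i) 0 l - Φ w 0 l)
  have hsum := ((((Matrix.posSemidef_self_mul_conjTranspose V).add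
    ((Matrix.posSemidef_vecMulVec_self_star α).smul hδ)).smul hc).add
      (Matrix.posSemidef_vecMulVec_self_star β))
  convert hsum using 1
  ext i j
  have hα : ∀ j, star (α j) = k w (p j) / k z (p j) := fun j => by
    simp only [α, star_div₀, hk.star_apply]
  have hβ : star (β j) = k w (p j) / k z (p j) * (k z w / k w w) - 1 := by
    simp only [β, star_sub, star_mul', hα, star_div₀, hk.star_apply, star_one]
  have hV : (V * Vᴴ) i j = α i * star (α j) * ((Φ (p i) * (Φ (p j))ᴴ) 0 0
      - (Φ w * (Φ (p j))ᴴ) 0 0 - (Φ (p i) * (Φ w)ᴴ) 0 0 + (Φ w * (Φ w)ᴴ) 0 0) := by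
    simp only [Matrix.mul_apply, Matrix.conjTranspose_apply, V, Matrix.of_apply,
      ← Finset.sum_sub_distrib, ← Finset.sum_add_distrib, Finset.mul_sum, star_mul', star_sub]
    exact Finset.sum_congr rfl fun _ _ => by ring
  rw [hΦ' _ ⟨i, rfl⟩ _ ⟨j, rfl⟩, hwy _ ⟨j, rfl⟩, hyw _ ⟨i, rfl⟩] at hV
  simp only [Matrix.add_apply, Matrix.smul_apply, Matrix.vecMulVec_apply, Pi.star_apply,
    smul_eq_mul, Matrix.of_apply, hV, hβ, hα]
  rw [pickF_change_base hnz z w]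
  simp only [β, α]
  ring

/-- **The inductive step.** Let `k` be a non-vanishing PSD kernel with the complete Pick
property, `N ≥ 2`, and `x 0, …, x N` points of `X` (zero-indexed, so these are the points
`x_1, …, x_{N+1}` of the paper).  If the `(N-1) × (N-1)` matrix
`(F_{x_N}(x_i,x_j))_{i,j=1,…,N-1}` is positive semidefinite, then so is the `N × N` matrix
`(F_{x_{N+1}}(x_i,x_j))_{i,j=1,…,N}`. -/
theorem pick_induction_step {X : Type*} (k : X → X → ℂ)
    (hpsd : IsPSDKernel k)
    (hnz : ∀ x y : X, k x y ≠ 0)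
    (hcp : CompletePickProperty k)
    (N : ℕ) (hN : 2 ≤ N) (x : Fin (N + 1) → X)
    (h : (Matrix.of fun i j : Fin (N - 1) =>
        pickF k (x ⟨N - 1, by omega⟩) (x (Fin.castLE (by omega) i))
          (x (Fin.castLE (by omega) j))).PosSemidef) :
    (Matrix.of fun i j : Fin N =>
        pickF k (x ⟨N, by omega⟩) (x (Fin.castLE (by omega) i))
          (x (Fin.castLE (by omega) j))).PosSemidef := by
  obtain ⟨M, rfl⟩ : ∃ M, N = M + 1 := ⟨N - 1, by omega⟩
  refine hcp.posSemidef_pickF hpsd hnz (fun i : Fin (M + 1) => x i.castSucc)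
    (z := x (Fin.last M).castSucc) ⟨Fin.last M, rfl⟩ (x (Fin.last (M + 1))) ?_
  exact Matrix.PosSemidef.of_castSucc h (fun i => pickF_self_left hnz _ _)
    (fun i => pickF_self_right hnz _ _)
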